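/- arXiv:2201.00357 — 4 statements merged into one kernel-verified Lean document; each statement's English description precedes it below -/
import Mathlib

section
/- Let N be a positive integer and e, γ integers. The sequence {α_n}_{n≥0} in Z/NZ defined by α_{n+1} = e·α_n + γ (mod N) has period N (the maximum possible) for every initial value α_0 ∈ Z/NZ, if and only if: γ is relatively prime to N; e ≡ 1 (mod ℓ) for every prime factor ℓ of N; and e ≡ 1 (mod 4) whenever 4 divides N. -/
open Finset in
theorem emultiplicity_geom_sum_of_odd {p : ℕ} (hp : p.Prime) (hodd : Odd p) {e : ℤ}
    (h : (p : ℤ) ∣ e - 1) (s : ℕ) :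
    emultiplicity (p : ℤ) (∑ i ∈ range s, e ^ i) = emultiplicity (p : ℤ) (s : ℤ) := by
  rcases eq_or_ne e 1 with rfl | he
  · simp
  have hpe : ¬(p : ℤ) ∣ e := fun hd => by
    have : (p : ℤ) ∣ 1 := by simpa using dvd_sub hd h
    exact (Nat.prime_iff_prime_int.mp hp).not_isUnit (isUnit_of_dvd_one this)
  have hmul := Int.emultiplicity_pow_sub_pow hp hodd h hpe s
  rw [one_pow, ← geom_sum_mul, emultiplicity_mul (Nat.prime_iff_prime_int.mp hp), add_comm,
    ← Int.natCast_emultiplicity] at hmul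
  refine ENat.add_right_injective_of_ne_top ?_ hmul
  rw [← finiteMultiplicity_iff_emultiplicity_ne_top, Int.finiteMultiplicity_iff]
  exact ⟨by simpa using hp.ne_one, sub_ne_zero.mpr he⟩

open Finset in
theorem emultiplicity_two_geom_sum {e : ℤ} (h : (4 : ℤ) ∣ e - 1) (s : ℕ) :
    emultiplicity (2 : ℤ) (∑ i ∈ range s, e ^ i) = emultiplicity (2 : ℤ) (s : ℤ) := by
  rcases eq_or_ne e 1 with rfl | he
  · simp
  have hmul := Int.two_pow_sub_pow' s h (by omega)
  rw [one_pow, ← geom_sum_mul, emultiplicity_mul Int.prime_two, add_comm] at hmul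
  refine ENat.add_right_injective_of_ne_top ?_ hmul
  rw [← finiteMultiplicity_iff_emultiplicity_ne_top, Int.finiteMultiplicity_iff]
  exact ⟨by simp, sub_ne_zero.mpr he⟩

open Finset in
theorem dvd_geom_sum_sub_natCast {d e : ℤ} (h : d ∣ e - 1) (s : ℕ) :
    d ∣ (∑ i ∈ range s, e ^ i) - s := by
  induction s with
  | zero => simp
  | succ s ih =>
    rw [sum_range_succ, Nat.cast_succ, add_sub_add_comm]
    exact dvd_add ih (h.trans (sub_one_dvd_pow_sub_one e s))

open Finset in
theorem natCast_dvd_geom_sum_iff {N : ℕ} {e : ℤ}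
    (h : ∀ ℓ : ℕ, ℓ.Prime → ℓ ∣ N → (ℓ : ℤ) ∣ e - 1) (h4 : 4 ∣ N → (4 : ℤ) ∣ e - 1) (s : ℕ) :
    (N : ℤ) ∣ ∑ i ∈ range s, e ^ i ↔ N ∣ s := by
  have key : ∀ p k : ℕ, p.Prime → p ^ k ∣ N →
      (p ^ k ∣ (∑ i ∈ range s, e ^ i).natAbs ↔ p ^ k ∣ s) := by
    intro p k hp hk
    rw [← Int.natCast_dvd, ← Int.natCast_dvd_natCast (n := s)]
    rcases Nat.eq_zero_or_pos k with rfl | hk0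
    · simp
    have hpe := h p hp ((dvd_pow_self p hk0.ne').trans hk)
    rcases hp.eq_two_or_odd' with rfl | hodd
    · rcases Nat.lt_or_ge k 2 with hk2 | hk2
      · obtain rfl : k = 1 := by omega
        have := dvd_geom_sum_sub_natCast hpe s
        simpa using dvd_iff_dvd_of_dvd_sub this
      · have := emultiplicity_two_geom_sum (h4 ((pow_dvd_pow 2 hk2).trans hk)) s
        push_cast
        rw [pow_dvd_iff_le_emultiplicity, this, pow_dvd_iff_le_emultiplicity]
    · push_cast
      rw [pow_dvd_iff_le_emultiplicity, emultiplicity_geom_sum_of_odd hp hodd hpe,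
        pow_dvd_iff_le_emultiplicity]
  rw [Int.natCast_dvd, Nat.dvd_iff_prime_pow_dvd_dvd, Nat.dvd_iff_prime_pow_dvd_dvd]
  exact ⟨fun H p k hp hk => (key p k hp hk).mp (H p k hp hk),
    fun H p k hp hk => (key p k hp hk).mpr (H p k hp hk)⟩

section LinearCongruential

open Finset

variable {R : Type*} [CommRing R] {a c : R} {α : ℕ → R}

theorem linearCongruential_add (hα : ∀ n, α (n + 1) = a * α n + c) (n s : ℕ) :
    α (n + s) = a ^ s * α n + c * ∑ i ∈ range s, a ^ i := by
  induction s with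
  | zero => simp
  | succ s ih =>
    rw [← add_assoc, hα, ih, geom_sum_succ]
    ring

theorem linearCongruential_add_sub (hα : ∀ n, α (n + 1) = a * α n + c) (n s : ℕ) :
    α (n + s) - α n = (∑ i ∈ range s, a ^ i) * ((a - 1) * α n + c) := by
  rw [linearCongruential_add hα]
  linear_combination (-α n) * geom_sum_mul a s

theorem linearCongruential_eventually_periodic (hα : ∀ n, α (n + 1) = a * α n + c) {i s : ℕ}
    (h : α (i + s) = α i) : ∀ n ≥ i, α (n + s) = α n := by
  intro n hn
  induction n, hn using Nat.le_induction with
  | base => exact h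
  | succ n _ ih => rw [add_right_comm, hα, hα, ih]

end LinearCongruential

open Finset in
theorem exists_dvd_mul_geom_sum_sub {N : ℕ} (hN : 0 < N) {e γ : ℤ} {α : ℕ → ZMod N} (h0 : α 0 = 0)
    (hα : ∀ n, α (n + 1) = (e : ZMod N) * α n + (γ : ZMod N))
    (hmin : N ∈ lowerBounds {s : ℕ | 0 < s ∧ ∃ n₀ : ℕ, ∀ n ≥ n₀, α (n + s) = α n}) (x : ℤ) :
    ∃ n, 0 < n ∧ (N : ℤ) ∣ γ * (∑ i ∈ range n, e ^ i) - x := by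
  have : NeZero N := ⟨hN.ne'⟩
  have hlt : ∀ i j, i < j → j < i + N → α i ≠ α j := by
    intro i j hij hj heq
    have := hmin ⟨Nat.sub_pos_of_lt hij, i, linearCongruential_eventually_periodic hα
      (by rw [Nat.add_sub_cancel' hij.le, heq])⟩
    omega
  have hinj : Function.Injective fun i : Fin N => α (i + 1) := by
    intro i j hij
    rcases lt_trichotomy (i : ℕ) j with h | h | h
    · exact absurd hij (hlt _ _ (by omega) (by omega))
    · exact Fin.ext h
    · exact absurd hij.symm (hlt _ _ (by omega) (by omega))
  obtain ⟨i, hi⟩ := ((Fintype.bijective_iff_injective_and_card _).mpr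
    ⟨hinj, by simp [ZMod.card]⟩).surjective (x : ZMod N)
  refine ⟨i + 1, by omega, ?_⟩
  have hsum := linearCongruential_add hα 0 (i + 1)
  rw [zero_add, h0, mul_zero, zero_add] at hsum
  rw [← ZMod.intCast_zmod_eq_zero_iff_dvd]
  push_cast
  rw [← hsum, sub_eq_zero]
  exact hi

open Finset in
theorem four_dvd_geom_sum_or {e : ℤ} (he : (4 : ℤ) ∣ e + 1) (n : ℕ) :
    (4 : ℤ) ∣ ∑ i ∈ range n, e ^ i ∨ (4 : ℤ) ∣ (∑ i ∈ range n, e ^ i) - 1 := by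
  induction n with
  | zero => simp
  | succ n ih =>
    rw [geom_sum_succ]
    obtain ⟨k, hk⟩ := he
    obtain rfl : e = 4 * k - 1 := by omega
    rcases ih with ⟨m, hm⟩ | ⟨m, hm⟩
    · right
      exact ⟨(4 * k - 1) * m, by rw [hm]; ring⟩
    · left
      rw [sub_eq_iff_eq_add] at hm
      exact ⟨(4 * k - 1) * m + k, by rw [hm]; ring⟩

/-- Hull–Dobell: The linear congruential sequence `α_{n+1} = e·α_n + γ` in `ℤ/Nℤ`
has maximal period `N` for every initial value `α₀` if and only if `γ` is coprime to `N`,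
`e ≡ 1 (mod ℓ)` for every prime factor `ℓ` of `N`, and `e ≡ 1 (mod 4)` whenever `4 ∣ N`. -/
theorem stmt1 (N : ℕ) (hN : 0 < N) (e γ : ℤ) :
    (∀ α₀ : ZMod N, ∀ α : ℕ → ZMod N, α 0 = α₀ →
        (∀ n, α (n + 1) = (e : ZMod N) * α n + (γ : ZMod N)) →
        IsLeast {s : ℕ | 0 < s ∧ ∃ n₀ : ℕ, ∀ n ≥ n₀, α (n + s) = α n} N) ↔
      (Int.gcd γ N = 1 ∧
        (∀ ℓ : ℕ, ℓ.Prime → ℓ ∣ N → (ℓ : ℤ) ∣ e - 1) ∧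
        (4 ∣ N → (4 : ℤ) ∣ e - 1)) := by
  constructor
  · intro H
    let α : ℕ → ZMod N := fun n => Nat.rec 0 (fun _ x => (e : ZMod N) * x + (γ : ZMod N)) n
    have hα : ∀ n, α (n + 1) = (e : ZMod N) * α n + (γ : ZMod N) := fun _ => rfl
    have hex := exists_dvd_mul_geom_sum_sub hN (α := α) rfl hα (H 0 α rfl hα).2
    have hcop : IsCoprime γ (N : ℤ) := by
      obtain ⟨n, -, k, hk⟩ := hex 1
      exact ⟨∑ i ∈ Finset.range n, e ^ i, -k, by linear_combination hk⟩
    have hsurj : ∀ y : ℤ, ∃ n, 0 < n ∧ (N : ℤ) ∣ (∑ i ∈ Finset.range n, e ^ i) - y := by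
      intro y
      obtain ⟨n, hn, hd⟩ := hex (γ * y)
      rw [← mul_sub] at hd
      exact ⟨n, hn, hcop.symm.dvd_of_dvd_mul_left hd⟩
    have hprime : ∀ ℓ : ℕ, ℓ.Prime → ℓ ∣ N → (ℓ : ℤ) ∣ e - 1 := by
      intro ℓ hℓ hℓN
      have hpr := Nat.prime_iff_prime_int.mp hℓ
      have hℓN' : (ℓ : ℤ) ∣ N := Int.natCast_dvd_natCast.mpr hℓN
      have hℓe : ¬(ℓ : ℤ) ∣ e := by
        intro hd
        obtain ⟨n, hn, hs⟩ := hsurj 0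
        rw [sub_zero] at hs
        have hpow : (ℓ : ℤ) ∣ e ^ n - 1 := by
          rw [← geom_sum_mul]
          exact (hℓN'.trans hs).mul_right _
        have : (ℓ : ℤ) ∣ 1 := by simpa using dvd_sub (dvd_pow hd hn.ne') hpow
        exact hpr.not_isUnit (isUnit_of_dvd_one this)
      by_contra hne
      obtain ⟨u, v, huv⟩ := (hpr.coprime_iff_not_dvd.mpr hne).symm
      obtain ⟨n, -, hs⟩ := hsurj (-u)
      apply hℓe
      apply hpr.dvd_of_dvd_pow (n := n)
      have : e ^ n = ((∑ i ∈ Finset.range n, e ^ i) - -u) * (e - 1) + v * ℓ := by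
        linear_combination -geom_sum_mul e n - huv
      rw [this]
      exact dvd_add ((hℓN'.trans hs).mul_right _) (dvd_mul_left _ _)
    refine ⟨Int.isCoprime_iff_gcd_eq_one.mp hcop, hprime, fun h4 => ?_⟩
    have h2 : (2 : ℤ) ∣ e - 1 := hprime 2 Nat.prime_two (dvd_trans (by norm_num) h4)
    by_contra hne
    obtain ⟨n, -, hs⟩ := hsurj 2
    have hs4 := (Int.natCast_dvd_natCast.mpr h4).trans hs
    have := four_dvd_geom_sum_or (e := e) (by omega) n
    push_cast at hs4
    omega
  · rintro ⟨hγ, hℓ, h4⟩ α₀ α - hα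
    have hdvd := natCast_dvd_geom_sum_iff hℓ h4
    refine ⟨⟨hN, 0, fun n _ => ?_⟩, ?_⟩
    · have hzero : ((∑ i ∈ Finset.range N, e ^ i : ℤ) : ZMod N) = 0 :=
        (ZMod.intCast_zmod_eq_zero_iff_dvd _ _).mpr ((hdvd N).mpr dvd_rfl)
      push_cast at hzero
      rw [← sub_eq_zero, linearCongruential_add_sub hα, hzero, zero_mul]
    · rintro s ⟨hs, n, hn⟩
      obtain ⟨x, hx⟩ := ZMod.intCast_surjective (α n)
      have hsub := linearCongruential_add_sub hα n s
      rw [hn n le_rfl, sub_self, ← hx] at hsub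
      have hd : (N : ℤ) ∣ (∑ i ∈ Finset.range s, e ^ i) * ((e - 1) * x + γ) := by
        rw [← ZMod.intCast_zmod_eq_zero_iff_dvd]
        push_cast
        exact hsub.symm
      have hcop : IsCoprime (N : ℤ) ((e - 1) * x + γ) := by
        rw [Int.isCoprime_iff_gcd_eq_one]
        by_contra hne
        obtain ⟨p, hp, hpd⟩ := Nat.exists_prime_and_dvd hne
        have hpd' := Int.natCast_dvd_natCast.mpr hpd
        have hpN : (p : ℤ) ∣ N := hpd'.trans (Int.gcd_dvd_left _ _)
        have hpγ : (p : ℤ) ∣ γ :=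
          (dvd_add_right ((hℓ p hp (Int.natCast_dvd_natCast.mp hpN)).mul_right x)).mp
            (hpd'.trans (Int.gcd_dvd_right _ _))
        have := Int.dvd_coe_gcd hpγ hpN
        rw [hγ] at this
        exact (Nat.prime_iff_prime_int.mp hp).not_isUnit (isUnit_of_dvd_one (by simpa using this))
      exact Nat.le_of_dvd hs ((hdvd s).mp (hcop.dvd_of_dvd_mul_right hd))
end

section
/- If M_1 and M_2 are positive integers with M_1 dividing M_2 and M_1 > 1, then for all integers a, b with 1 ≤ a ≤ M_1 and 1 ≤ b ≤ M_2, one has lcm(a, b) < M_1 · M_2. -/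
/-- If `M₁ ∣ M₂` and `M₁ > 1`, then for all `1 ≤ a ≤ M₁` and `1 ≤ b ≤ M₂`,
`lcm(a, b) < M₁ · M₂`. -/
theorem stmt2 (M₁ M₂ : ℕ) (hM₁pos : 0 < M₁) (hM₂pos : 0 < M₂) (hdvd : M₁ ∣ M₂) (hM₁ : 1 < M₁)
    (a b : ℕ) (ha₁ : 1 ≤ a) (ha₂ : a ≤ M₁) (hb₁ : 1 ≤ b) (hb₂ : b ≤ M₂) :
    Nat.lcm a b < M₁ * M₂ := by
  have hle : Nat.lcm a b ≤ a * b := Nat.le_of_dvd (by positivity) (Nat.lcm_dvd_mul a b)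
  rcases hb₂.lt_or_eq with hb | rfl
  · calc Nat.lcm a b ≤ a * b := hle
      _ ≤ M₁ * b := Nat.mul_le_mul_right b ha₂
      _ < M₁ * M₂ := Nat.mul_lt_mul_of_pos_left hb hM₁pos
  · rcases ha₂.lt_or_eq with ha | rfl
    · exact hle.trans_lt (Nat.mul_lt_mul_of_pos_right ha hM₂pos)
    · rw [Nat.lcm_eq_right hdvd]
      exact lt_mul_of_one_lt_left hM₂pos hM₁
end

section
/- If η, η̄ ∈ L are not both zero, then the function f = η·x + η̄·y in the function field L(E) satisfies condition (A): there is no G ∈ L(E) with f = G^p − G. (In particular, f is nonconstant, its only pole is at O, and that pole has order at most 3, whereas any G^p − G with G nonconstant having its only pole at O would have a pole of order at least 2p ≥ 4 there.) -/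
open Polynomial

theorem Ideal.isPrincipal_of_mul_eq_span_singleton {R : Type*} [CommRing R] [IsDomain R]
    [IsLocalRing R] {I J : Ideal R} {a : R} (ha : a ≠ 0) (h : I * J = Ideal.span {a}) :
    I.IsPrincipal := by
  have key : ∃ z ∈ I, ∃ w ∈ J, ∃ t : R, IsUnit t ∧ z * w = a * t := by
    by_contra! hcon
    have hle : I * J ≤ Ideal.span {a} * IsLocalRing.maximalIdeal R := by
      refine Ideal.mul_le.mpr fun z hz w hw => ?_
      have hzw : z * w ∈ Ideal.span {a} := h ▸ Ideal.mul_mem_mul hz hw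
      obtain ⟨t, ht⟩ := Ideal.mem_span_singleton.mp hzw
      exact Ideal.mem_span_singleton_mul.mpr ⟨t, fun hu => hcon z hz w hw t hu ht, ht.symm⟩
    obtain ⟨t, ht, hat⟩ := Ideal.mem_span_singleton_mul.mp
      (hle (h ▸ Ideal.mem_span_singleton_self a))
    exact ht ((mul_eq_left₀ ha).mp hat ▸ isUnit_one)
  obtain ⟨z, hz, w, hw, t, ht, hzw⟩ := key
  refine ⟨z, le_antisymm (fun u hu => ?_) ((Ideal.span_singleton_le_iff_mem _).mpr hz)⟩
  obtain ⟨s, hs⟩ := Ideal.mem_span_singleton.mp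
    (show u * w ∈ Ideal.span {a} from h ▸ Ideal.mul_mem_mul hu hw)
  obtain ⟨t, rfl⟩ := ht
  have hw0 : w ≠ 0 := by
    rintro rfl
    exact ha (by simpa using hzw.symm)
  refine Ideal.mem_span_singleton.mpr ⟨s * ↑t⁻¹, mul_right_cancel₀ hw0 ?_⟩
  calc u * w = a * (↑t * ↑t⁻¹) * s := by rw [hs, Units.mul_inv, mul_one]
    _ = z * w * ↑t⁻¹ * s := by rw [hzw]; ring
    _ = z * (s * ↑t⁻¹) * w := by ring

theorem prod_sub_zmod_eq_pow_sub_self {p : ℕ} [Fact p.Prime] {A : Type*} [CommRing A]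
    (φ : ZMod p →+* A) (g : A) : ∏ c : ZMod p, (g - φ c) = g ^ p - g := by
  have h : (X ^ p - X : (ZMod p)[X]) = ∏ c : ZMod p, (X - C c) := by
    have hroots : (X ^ p - X : (ZMod p)[X]).roots = Finset.univ.val := by
      simpa using FiniteField.roots_X_pow_card_sub_X (ZMod p)
    have hmonic : (X ^ p - X : (ZMod p)[X]).Monic :=
      monic_X_pow_sub (by simpa using (Fact.out : p.Prime).one_lt)
    have := (GaloisField.splits_zmod_X_pow_sub_X p).eq_prod_roots_of_monic hmonic
    rw [hroots] at this
    exact this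
  simpa [eval₂_finsetProd] using (congrArg (eval₂ φ g) h).symm

namespace WeierstrassCurve.Affine.CoordinateRing

variable {F : Type*} [Field F] {W : WeierstrassCurve.Affine F}

theorem equation_of_map_polynomial_eq_zero {K : Type*} [Field K] (f : F[X][X] →+* K) {x y : F}
    (hx : f (C (C x)) = f (C X)) (hy : f (C (C y)) = f X) (h : f W.polynomial = 0) :
    W.Equation x y := by
  rw [equation_iff', ← map_eq_zero (f.comp (C.comp C))]
  simp only [polynomial, map_add, map_sub, map_mul, map_pow, RingHom.comp_apply, hx, hy] at h ⊢
  rwa [add_mul, ← add_assoc] at h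

theorem exists_equation_XYIdeal_eq [IsAlgClosed F] (P : Ideal W.CoordinateRing) [P.IsMaximal] :
    ∃ x y : F, W.Equation x y ∧ XYIdeal W x (C y) = P := by
  let _ : Field (W.CoordinateRing ⧸ P) := Ideal.Quotient.field P
  have : Module.Finite F (W.CoordinateRing ⧸ P) := finite_of_finite_type_of_isJacobsonRing _ _
  have hsurj : Function.Surjective (algebraMap F (W.CoordinateRing ⧸ P)) :=
    IsAlgClosed.algebraMap_bijective_of_isIntegral.2
  obtain ⟨x, hx⟩ := hsurj (Ideal.Quotient.mk P (mk W (C X)))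
  obtain ⟨y, hy⟩ := hsurj (Ideal.Quotient.mk P (mk W X))
  have hmap (a : F) : algebraMap F (W.CoordinateRing ⧸ P) a =
      Ideal.Quotient.mk P (mk W (C (C a))) := rfl
  rw [hmap] at hx hy
  have hle : XYIdeal W x (C y) ≤ P := by
    rw [XYIdeal, Ideal.span_le, Set.insert_subset_iff, Set.singleton_subset_iff]
    constructor
    · simp only [XClass, SetLike.mem_coe, ← Ideal.Quotient.eq_zero_iff_mem, map_sub, hx, sub_self]
    · simp only [YClass, SetLike.mem_coe, ← Ideal.Quotient.eq_zero_iff_mem, map_sub, hy, sub_self]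
  have heq : W.Equation x y := by
    refine equation_of_map_polynomial_eq_zero ((Ideal.Quotient.mk P).comp (mk W)) hx hy ?_
    rw [RingHom.comp_apply, AdjoinRoot.mk_self, map_zero]
  refine ⟨x, y, heq, ?_⟩
  have : (XYIdeal W x (C y)).IsMaximal :=
    Ideal.Quotient.maximal_of_isField _
      ((quotientXYIdealEquiv heq).toMulEquiv.isField (Field.toIsField F))
  exact this.eq_of_le (Ideal.IsMaximal.ne_top ‹_›) hle

theorem isIntegrallyClosed_of_Δ_ne_zero [IsAlgClosed F] (hΔ : W.Δ ≠ 0) :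
    IsIntegrallyClosed W.CoordinateRing := by
  refine IsIntegrallyClosed.of_localization_maximal fun P _ _ => ?_
  obtain ⟨x, y, hxy, hP⟩ := exists_equation_XYIdeal_eq P
  have : IsNoetherianRing (Localization.AtPrime P) :=
    IsLocalization.isNoetherianRing P.primeCompl _ inferInstance
  have hprin : (IsLocalRing.maximalIdeal (Localization.AtPrime P)).IsPrincipal := by
    have h := congrArg (Ideal.map (algebraMap _ (Localization.AtPrime P)))
      (XYIdeal_neg_mul ((equation_iff_nonsingular_of_Δ_ne_zero hΔ).mp hxy))
    rw [Ideal.map_mul, mul_comm, XIdeal, Ideal.map_span, Set.image_singleton, hP,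
      Localization.AtPrime.map_eq_maximalIdeal] at h
    refine Ideal.isPrincipal_of_mul_eq_span_singleton ?_ h
    exact (map_ne_zero_iff _ (IsLocalization.injective (Localization.AtPrime P)
      P.primeCompl_le_nonZeroDivisors)).mpr (XClass_ne_zero x)
  exact (((tfae_of_isNoetherianRing_of_isLocalRing_of_isDomain (Localization.AtPrime P)).out 4 3 :
      _ ↔ IsIntegrallyClosed (Localization.AtPrime P) ∧ _).mp hprin).1

theorem two_le_natDegree_norm_smul_basis {P Q : F[X]} (h : Q ≠ 0 ∨ 1 ≤ P.natDegree) :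
    2 ≤ (Algebra.norm F[X] (P • (1 : W.CoordinateRing) + Q • mk W X)).natDegree := by
  refine le_natDegree_of_coe_le_degree ?_
  rw [degree_norm_smul_basis]
  rcases h with h | h
  · refine le_max_of_le_right ?_
    rw [degree_eq_natDegree h]
    rw [nsmul_eq_mul]
    norm_cast
    omega
  · have hP : P ≠ 0 := by rintro rfl; simp at h
    refine le_max_of_le_left ?_
    rw [degree_eq_natDegree hP]
    rw [nsmul_eq_mul]
    norm_cast
    omega

theorem natDegree_norm_le_three (a b : F) :
    (Algebra.norm F[X] ((C a * X : F[X]) • (1 : W.CoordinateRing) +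
      (C b : F[X]) • mk W X)).natDegree ≤ 3 := by
  refine natDegree_le_of_degree_le ?_
  rw [degree_norm_smul_basis]
  refine max_le ?_ ?_
  · grw [degree_C_mul_X_le]
    norm_cast
  · grw [degree_C_le]
    norm_cast

end WeierstrassCurve.Affine.CoordinateRing

open WeierstrassCurve.Affine.CoordinateRing in

/-- over an algebraically closed field `L` of characteristic `p`, if `η, η̄ ∈ L`
are not both zero, then the function `f = η·x + η̄·y` in the function field `L(E)` satisfies
condition (A): there is no `G ∈ L(E)` with `f = G^p − G`.  Here `x, y` are the affine
Weierstrass coordinate functions, i.e. the images in the coordinate ring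
`L[E] = L[X][Y]/⟨W⟩` of the polynomials `X` and `Y`. -/
theorem stmt14 (p : ℕ) [Fact p.Prime] {L : Type*} [Field L] [IsAlgClosed L] [CharP L p]
    (W : WeierstrassCurve.Affine L) (hΔ : W.Δ ≠ 0)
    (η η' : L) (hη : ¬(η = 0 ∧ η' = 0)) :
    ∀ G : W.FunctionField,
      algebraMap W.CoordinateRing W.FunctionField
          (WeierstrassCurve.Affine.CoordinateRing.mk W
            (Polynomial.C (Polynomial.C η * Polynomial.X) +
              Polynomial.C (Polynomial.C η') * Polynomial.X))
        ≠ G ^ p - G := by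
  intro G hG
  have hp : p.Prime := Fact.out
  have := isIntegrallyClosed_of_Δ_ne_zero hΔ
  have hint : IsIntegral W.CoordinateRing G := by
    refine ⟨X ^ p - (X + C (mk W (C (C η * X) + C (C η') * X))), monic_X_pow_sub ?_, ?_⟩
    · exact (degree_X_add_C _).trans_lt (by exact_mod_cast hp.one_lt)
    · rw [eval₂_sub, eval₂_add, eval₂_X_pow, eval₂_X, eval₂_C, hG]
      ring
  obtain ⟨g, rfl⟩ := IsIntegrallyClosed.algebraMap_eq_of_integral hint
  rw [← map_pow, ← map_sub] at hG
  replace hG := IsFractionRing.injective W.CoordinateRing W.FunctionField hG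
  rw [map_add (mk W), map_mul (mk W), ← mul_one (mk W (C (C η * X))), ← smul, ← smul] at hG
  obtain ⟨P, Q, rfl⟩ := exists_smul_basis_eq g
  by_cases h : Q ≠ 0 ∨ 1 ≤ P.natDegree
  · let φ : ZMod p →+* L := ZMod.castHom dvd_rfl L
    have hle := natDegree_norm_le_three (W := W) η η'
    rw [hG, ← prod_sub_zmod_eq_pow_sub_self ((algebraMap L W.CoordinateRing).comp φ),
      map_prod] at hle
    have hsub (c : ZMod p) : P • (1 : W.CoordinateRing) + Q • mk W X -
        (algebraMap L W.CoordinateRing).comp φ c =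
          (P - C (φ c)) • (1 : W.CoordinateRing) + Q • mk W X := by
      have : (algebraMap L W.CoordinateRing).comp φ c = mk W (C (C (φ c))) := rfl
      rw [this, sub_smul, smul (C (φ c)), mul_one]
      ring
    have htwo (c : ZMod p) : 2 ≤ (Algebra.norm L[X] (P • (1 : W.CoordinateRing) + Q • mk W X -
        (algebraMap L W.CoordinateRing).comp φ c)).natDegree := by
      rw [hsub]
      exact two_le_natDegree_norm_smul_basis (by rwa [natDegree_sub_C])
    rw [natDegree_prod _ _ fun c _ h0 => by
      have := htwo c
      rw [h0, natDegree_zero] at this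
      omega] at hle
    have := (Finset.card_nsmul_le_sum Finset.univ _ 2 fun c _ => htwo c).trans hle
    rw [Finset.card_univ, ZMod.card, smul_eq_mul] at this
    have := hp.two_le
    omega
  · push Not at h
    obtain ⟨rfl, hP⟩ := h
    rw [eq_C_of_natDegree_eq_zero (by omega : P.natDegree = 0)] at hG
    set c := P.coeff 0
    have h0 : (C η * X - C (c ^ p - c) : L[X]) • (1 : W.CoordinateRing) +
        (C η' : L[X]) • mk W X = 0 := by
      rw [sub_smul, sub_add_eq_add_sub, hG, zero_smul, add_zero, smul, smul]
      simp
    obtain ⟨h1, h2⟩ := smul_basis_eq_zero h0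
    refine hη ⟨?_, C_eq_zero.mp h2⟩
    have h3 := congrArg (coeff · 1) h1
    simp only [coeff_sub, coeff_C_mul_X, coeff_C, coeff_zero] at h3
    simpa using h3
end

section
/- (Box–Muller) Let U_1, U_2 be independent random variables, each uniformly distributed on (0,1). Then the random vector (V_1, V_2) with V_1 = √(−2·ln U_1)·cos(2π U_2) and V_2 = √(−2·ln U_1)·sin(2π U_2) has the standard normal distribution on R² (i.e. V_1 and V_2 are independent standard normal random variables). Equivalently, the pushforward of the uniform probability measure on (0,1)² under the map (u_1, u_2) ↦ (√(−2 ln u_1) cos(2π u_2), √(−2 ln u_1) sin(2π u_2)) is the standard Gaussian measure on R². -/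
open MeasureTheory ProbabilityTheory

open Real Set

open scoped ENNReal

lemma image_exp_neg_sq_half_Ioi :
    (fun r : ℝ => exp (-r ^ 2 / 2)) '' Ioi 0 = Ioo 0 1 := by
  ext u
  constructor
  · rintro ⟨r, hr, rfl⟩
    have hr : 0 < r := hr
    exact ⟨exp_pos _, exp_lt_one_iff.2 (by nlinarith [pow_pos hr 2])⟩
  · rintro ⟨h0, h1⟩
    have hlog : 0 < -2 * log u := by linarith [log_neg h0 h1]
    refine ⟨√(-2 * log u), sqrt_pos.2 hlog, ?_⟩
    simp only [sq_sqrt hlog.le]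
    rw [show -(-2 * log u) / 2 = log u by ring, exp_log h0]

lemma sqrt_neg_two_mul_log_exp_neg_sq_half {r : ℝ} (hr : 0 ≤ r) :
    √(-2 * log (exp (-r ^ 2 / 2))) = r := by
  rw [log_exp, show -2 * (-r ^ 2 / 2) = r ^ 2 by ring, sqrt_sq hr]

/-- The radial part of the Box–Muller transform has the Rayleigh distribution. -/
lemma map_sqrt_neg_two_mul_log_uniform :
    (volume.restrict (Ioo (0 : ℝ) 1)).map (fun u => √(-2 * log u)) =
      (volume.restrict (Ioi 0)).withDensity (fun r => ENNReal.ofReal (r * exp (-r ^ 2 / 2))) := by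
  refine Measure.ext_of_lintegral _ fun f hf => ?_
  rw [lintegral_map hf (by fun_prop), lintegral_withDensity_eq_lintegral_mul _ (by fun_prop) hf,
    ← image_exp_neg_sq_half_Ioi,
    lintegral_image_eq_lintegral_abs_deriv_mul measurableSet_Ioi
      (f' := fun r => -(r * exp (-r ^ 2 / 2)))]
  · refine setLIntegral_congr_fun measurableSet_Ioi fun r hr => ?_
    have hr : 0 < r := hr
    simp only [Pi.mul_apply]
    rw [sqrt_neg_two_mul_log_exp_neg_sq_half hr.le, abs_neg, abs_of_pos (by positivity)]
  · intro r _
    have h : HasDerivAt (fun r : ℝ => -r ^ 2 / 2) (-r) r := by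
      convert! ((hasDerivAt_pow 2 r).neg.div_const 2) using 1
      simp
      ring
    convert! h.exp.hasDerivWithinAt using 1
    ring
  · intro r hr s hs h
    have h' : exp (-r ^ 2 / 2) = exp (-s ^ 2 / 2) := h
    rw [← sqrt_neg_two_mul_log_exp_neg_sq_half (le_of_lt hr), h',
      sqrt_neg_two_mul_log_exp_neg_sq_half (le_of_lt hs)]

lemma map_two_pi_mul_sub_pi_uniform :
    (volume.restrict (Ioo (0 : ℝ) 1)).map (fun u => 2 * π * u - π) =
      (volume.restrict (Ioo (-π) π)).withDensity (fun _ => ENNReal.ofReal (2 * π)⁻¹) := by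
  have hπ := pi_pos
  have himage : (fun θ : ℝ => (2 * π)⁻¹ * θ + 1 / 2) '' Ioo (-π) π = Ioo 0 1 := by
    rw [image_affine_Ioo (by positivity)]
    congr 1 <;> field_simp <;> norm_num
  refine Measure.ext_of_lintegral _ fun f hf => ?_
  rw [lintegral_map hf (by fun_prop), lintegral_withDensity_eq_lintegral_mul _ (by fun_prop) hf,
    ← himage,
    lintegral_image_eq_lintegral_abs_deriv_mul measurableSet_Ioo (f' := fun _ => (2 * π)⁻¹)]
  · refine lintegral_congr fun θ => ?_
    simp only [Pi.mul_apply]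
    rw [abs_of_pos (by positivity)]
    congr 2
    field_simp
    ring
  · intro θ _
    simpa using (((hasDerivAt_id θ).const_mul (2 * π)⁻¹).add_const (1 / 2)).hasDerivWithinAt
  · intro θ _ η _ h
    have h' : (2 * π)⁻¹ * θ + 1 / 2 = (2 * π)⁻¹ * η + 1 / 2 := h
    exact mul_left_cancel₀ (by positivity) (add_right_cancel h')

lemma gaussianPDFReal_mul_gaussianPDFReal (x y : ℝ) :
    gaussianPDFReal 0 1 x * gaussianPDFReal 0 1 y =
      (2 * π)⁻¹ * exp (-(x ^ 2 + y ^ 2) / 2) := by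
  simp only [gaussianPDFReal, NNReal.coe_one, mul_one, sub_zero]
  rw [mul_mul_mul_comm, ← mul_inv, mul_self_sqrt (by positivity), ← exp_add]
  congr 2
  ring

lemma gaussianReal_prod_gaussianReal_eq_withDensity :
    (gaussianReal 0 1).prod (gaussianReal 0 1) =
      (volume : Measure (ℝ × ℝ)).withDensity
        (fun p => ENNReal.ofReal ((2 * π)⁻¹ * exp (-(p.1 ^ 2 + p.2 ^ 2) / 2))) := by
  rw [gaussianReal_of_var_ne_zero 0 one_ne_zero,
    prod_withDensity (measurable_gaussianPDF 0 1) (measurable_gaussianPDF 0 1),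
    ← Measure.volume_eq_prod]
  simp only [gaussianPDF, ← ENNReal.ofReal_mul (gaussianPDFReal_nonneg _ _ _),
    gaussianPDFReal_mul_gaussianPDFReal]

/-- Box–Muller: the pushforward of the uniform probability measure on `(0,1)²`
under the map `(u₁, u₂) ↦ (√(−2·ln u₁)·cos(2π u₂), √(−2·ln u₁)·sin(2π u₂))` is the standard
Gaussian measure on `ℝ²`. -/
theorem stmt17 :
    Measure.map
        (fun u : ℝ × ℝ =>
          (Real.sqrt (-2 * Real.log u.1) * Real.cos (2 * Real.pi * u.2),
           Real.sqrt (-2 * Real.log u.1) * Real.sin (2 * Real.pi * u.2)))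
        (volume.restrict (Set.Ioo (0 : ℝ) 1 ×ˢ Set.Ioo (0 : ℝ) 1))
      = (gaussianReal 0 1).prod (gaussianReal 0 1) := by
  -- Shifting the angle by `π` to match the range of `polarCoord` negates the vector.
  have hcomp : (fun u : ℝ × ℝ => (√(-2 * log u.1) * cos (2 * π * u.2),
      √(-2 * log u.1) * sin (2 * π * u.2))) = (fun p => -polarCoord.symm p) ∘
        Prod.map (fun u => √(-2 * log u)) (fun u => 2 * π * u - π) := by
    ext u <;> simp [cos_sub_pi, sin_sub_pi]
  have hneg : Measurable fun p : ℝ × ℝ => -polarCoord.symm p :=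
    continuous_polarCoord_symm.neg.measurable
  rw [hcomp, ← Measure.map_map hneg (by fun_prop), Measure.volume_eq_prod,
    ← Measure.prod_restrict, ← Measure.map_prod_map _ _ (by fun_prop) (by fun_prop),
    map_sqrt_neg_two_mul_log_uniform, map_two_pi_mul_sub_pi_uniform,
    prod_withDensity (by fun_prop) (by fun_prop), Measure.prod_restrict,
    ← Measure.volume_eq_prod, gaussianReal_prod_gaussianReal_eq_withDensity]
  refine Measure.ext_of_lintegral _ fun f hf => ?_
  have hfneg : Measurable fun p => f (-polarCoord.symm p) := hf.comp hneg
  rw [lintegral_map hf hneg,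
    lintegral_withDensity_eq_lintegral_mul _ (by fun_prop) hfneg,
    lintegral_withDensity_eq_lintegral_mul _ (by fun_prop) hf,
    ← lintegral_neg_eq_self (μ := (volume : Measure (ℝ × ℝ))), ← lintegral_comp_polarCoord_symm]
  refine setLIntegral_congr_fun polarCoord.open_target.measurableSet fun p hp => ?_
  have hp : 0 < p.1 := hp.1
  have hsq : (p.1 * cos p.2) ^ 2 + (p.1 * sin p.2) ^ 2 = p.1 ^ 2 := by
    linear_combination p.1 ^ 2 * cos_sq_add_sin_sq p.2
  simp only [Pi.mul_apply, smul_eq_mul, Prod.fst_neg, Prod.snd_neg, neg_sq,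
    polarCoord_symm_apply, hsq]
  rw [← mul_assoc, ← ENNReal.ofReal_mul (by positivity), ← ENNReal.ofReal_mul (by positivity)]
  congr 2
  ring
end
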